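/- arXiv:2207.12213 — 2 statements merged into one kernel-verified Lean document; each statement's English description precedes it below -/
import Mathlib

section
/- Let G be a finite simple graph with vertex set V and e edges, and let k ≥ 3 be an odd integer such that every vertex of G has degree at least k−1. Define a 2-CNF multiset φ over variables V as follows: for each vertex x, the clause A_x = (¬x) with multiplicity deg(x) − (k−1)/2; for each vertex x and each neighbor y of x, the clause (x ∨ ¬y) with multiplicity 1; and for each pair {x,y} of distinct non-adjacent vertices, the clause (x ∨ y) with multiplicity 4e. Let σ be the total assignment with σ(x) = 1 for all x ∈ V. If K ⊆ V is a clique of size k in G, then the partial assignment μ defined by μ(x) = ⊥ for x ∈ K and μ(x) = 1 for x ∉ K satisfies E(φ, μ) = E(φ, σ). -/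
/-- The set of completions of a partial assignment `μ`. -/
def Comp {α : Type} [Fintype α] [DecidableEq α] (μ : α → Option Bool) :
    Finset (α → Bool) :=
  Finset.univ.filter (fun z => ∀ i, ∀ b : Bool, μ i = some b → z i = b)

/-- The number of variables undefined in a partial assignment. -/
def numUndef {α : Type} [Fintype α] [DecidableEq α] (μ : α → Option Bool) : ℕ :=
  (Finset.univ.filter (fun i => μ i = none)).card

/-- A total assignment `z` satisfies a clause, represented as a list of
literals `(i, b)` (where `b = true` is the positive literal `x_i` and
`b = false` is the negative literal `¬x_i`). -/
def SatClause {α : Type} (C : List (α × Bool)) (z : α → Bool) : Prop :=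
  ∃ l ∈ C, z l.1 = l.2

instance {α : Type} (C : List (α × Bool)) (z : α → Bool) :
    Decidable (SatClause C z) := by
  unfold SatClause; infer_instance

/-- The number of completions of `μ` satisfying the clause `C`. -/
def satCount {α : Type} [Fintype α] [DecidableEq α]
    (C : List (α × Bool)) (μ : α → Option Bool) : ℕ :=
  ((Comp μ).filter (fun z => SatClause C z)).card

/-- `E(φ, μ)`: the expected number of clauses of the CNF multiset `φ`
satisfied by a uniformly random completion of the partial assignment `μ`. -/
noncomputable def Eexp {α : Type} [Fintype α] [DecidableEq α]
    (φ : Multiset (List (α × Bool))) (μ : α → Option Bool) : ℝ :=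
  (φ.map (fun C => (satCount C μ : ℝ))).sum / 2 ^ numUndef μ

/-- The 2-CNF multiset of the reduction from `Clique`: for each vertex `x`
the clause `(¬x)` with multiplicity `deg(x) − (k−1)/2`; for each vertex `x`
and each neighbor `y` of `x` the clause `(x ∨ ¬y)`; and for each pair of
distinct non-adjacent vertices `{x, y}` the clause `(x ∨ y)` with
multiplicity `4e`, where `e` is the number of edges. -/
def phiG {V : Type} [Fintype V] [DecidableEq V] [LinearOrder V]
    (G : SimpleGraph V) [DecidableRel G.Adj] (k : ℕ) :
    Multiset (List (V × Bool)) :=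
  (Finset.univ.val.bind fun x : V =>
      Multiset.replicate (G.degree x - (k - 1) / 2) [(x, false)])
  + (Finset.univ.val.bind fun x : V =>
      (G.neighborFinset x).val.map fun y => [(x, true), (y, false)])
  + (Finset.univ.val.bind fun x : V =>
      Finset.univ.val.bind fun y : V =>
        if x < y ∧ ¬ G.Adj x y then
          Multiset.replicate (4 * G.edgeFinset.card) [(x, true), (y, true)]
        else 0)

/-- The partial assignment that is undefined on `K` and `true` elsewhere. -/
def undefOn {α : Type} [DecidableEq α] (K : Finset α) : α → Option Bool :=
  fun i => if i ∈ K then none else some true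

theorem card_piFinset_univ_or_singleton {α : Type} [Fintype α] [DecidableEq α]
    (S : Finset α) (f : α → Bool) :
    (Fintype.piFinset fun i => if i ∈ S then Finset.univ else {f i}).card = 2 ^ S.card := by
  rw [Fintype.card_piFinset]
  have h : ∀ i, (if i ∈ S then (Finset.univ : Finset Bool) else {f i}).card
      = if i ∈ S then 2 else 1 := by
    intro i; split_ifs <;> simp
  simp only [h]
  simp

theorem mem_Comp_undefOn {α : Type} [Fintype α] [DecidableEq α] {K : Finset α}
    {z : α → Bool} : z ∈ Comp (undefOn K) ↔ ∀ i, i ∉ K → z i = true := by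
  rw [Comp, Finset.mem_filter, and_iff_right (Finset.mem_univ z)]
  refine forall_congr' fun i => ?_
  by_cases hi : i ∈ K <;> simp [undefOn, hi]

theorem numUndef_undefOn {α : Type} [Fintype α] [DecidableEq α] (K : Finset α) :
    numUndef (undefOn K) = K.card := by
  unfold numUndef undefOn
  congr 1
  ext i
  simp

theorem card_Comp_undefOn {α : Type} [Fintype α] [DecidableEq α] (K : Finset α) :
    (Comp (undefOn K)).card = 2 ^ K.card := by
  rw [← card_piFinset_univ_or_singleton K fun _ => true]
  congr 1
  ext z
  rw [mem_Comp_undefOn, Fintype.mem_piFinset]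
  refine forall_congr' fun i => ?_
  by_cases hi : i ∈ K <;> simp [hi]

theorem card_filter_Comp_undefOn {α : Type} [Fintype α] [DecidableEq α] {K S : Finset α}
    (hS : S ⊆ K) (f : α → Bool) :
    ((Comp (undefOn K)).filter fun z => ∀ i ∈ S, z i = f i).card * 2 ^ S.card
      = 2 ^ K.card := by
  have h : ((Comp (undefOn K)).filter fun z => ∀ i ∈ S, z i = f i)
      = Fintype.piFinset fun i =>
          if i ∈ K \ S then Finset.univ else {if i ∈ S then f i else true} := by
    ext z
    rw [Finset.mem_filter, mem_Comp_undefOn, Fintype.mem_piFinset, ← forall_and]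
    refine forall_congr' fun i => ?_
    have := @hS i
    by_cases hi : i ∈ K <;> by_cases hs : i ∈ S <;> simp_all
  rw [h, card_piFinset_univ_or_singleton, ← pow_add, Finset.card_sdiff_add_card_eq_card hS]

theorem card_filter_Comp_undefOn_eq {α : Type} [Fintype α] [DecidableEq α] {K : Finset α}
    {x : α} (hx : x ∈ K) (b : Bool) :
    (((Comp (undefOn K)).filter fun z => z x = b).card : ℝ) = 2 ^ K.card * (1 / 2) := by
  have h := card_filter_Comp_undefOn (Finset.singleton_subset_iff.2 hx) fun _ => b
  simp only [Finset.mem_singleton, forall_eq, Finset.card_singleton, pow_one] at h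
  have h' := congrArg (Nat.cast (R := ℝ)) h
  push_cast at h'
  linarith

/-- The probability that a random completion of `μ` satisfies `C`. -/
noncomputable def satProb {α : Type} [Fintype α] [DecidableEq α]
    (C : List (α × Bool)) (μ : α → Option Bool) : ℝ :=
  satCount C μ / 2 ^ numUndef μ

theorem Eexp_eq_sum_satProb {α : Type} [Fintype α] [DecidableEq α]
    (φ : Multiset (List (α × Bool))) (μ : α → Option Bool) :
    Eexp φ μ = (φ.map fun C => satProb C μ).sum := by
  simp only [Eexp, satProb, div_eq_mul_inv, Multiset.sum_map_mul_right]

theorem satProb_undefOn_of_eq {α : Type} [Fintype α] [DecidableEq α] {C : List (α × Bool)}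
    {K : Finset α} {p : ℝ} (h : (satCount C (undefOn K) : ℝ) = 2 ^ K.card * p) :
    satProb C (undefOn K) = p := by
  rw [satProb, h, numUndef_undefOn]
  field_simp

theorem satProb_undefOn_of_forall {α : Type} [Fintype α] [DecidableEq α]
    {C : List (α × Bool)} {K : Finset α} (h : ∀ z ∈ Comp (undefOn K), SatClause C z) :
    satProb C (undefOn K) = 1 := by
  apply satProb_undefOn_of_eq
  rw [satCount, Finset.filter_true_of_mem h, card_Comp_undefOn]
  simp

theorem satProb_undefOn_neg {α : Type} [Fintype α] [DecidableEq α] (K : Finset α) (x : α) :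
    satProb [(x, false)] (undefOn K) = if x ∈ K then 1 / 2 else 0 := by
  apply satProb_undefOn_of_eq
  split_ifs with hx
  · rw [← card_filter_Comp_undefOn_eq hx false]
    simp [satCount, SatClause]
  · rw [satCount, mul_zero, Nat.cast_eq_zero, Finset.card_eq_zero, Finset.filter_eq_empty_iff]
    intro z hz
    simp [SatClause, mem_Comp_undefOn.1 hz x hx]

theorem satProb_undefOn_pos_neg {α : Type} [Fintype α] [DecidableEq α] (K : Finset α)
    {x y : α} (hxy : x ≠ y) :
    satProb [(x, true), (y, false)] (undefOn K)
      = if x ∈ K then (if y ∈ K then 3 / 4 else 1 / 2) else 1 := by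
  split_ifs with hx hy
  · apply satProb_undefOn_of_eq
    have hS : ({x, y} : Finset α) ⊆ K := by
      intro i; simp only [Finset.mem_insert, Finset.mem_singleton]; rintro (rfl | rfl) <;> assumption
    have h := card_filter_Comp_undefOn hS fun i => decide (i = y)
    rw [Finset.card_pair hxy] at h
    have hsplit := Finset.card_filter_add_card_filter_not (s := Comp (undefOn K))
      (SatClause [(x, true), (y, false)])
    have hnot : ((Comp (undefOn K)).filter fun z => ¬ SatClause [(x, true), (y, false)] z)
        = (Comp (undefOn K)).filter fun z => ∀ i ∈ ({x, y} : Finset α), z i = decide (i = y) := by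
      refine Finset.filter_congr fun z _ => ?_
      simp [SatClause, hxy]
    rw [hnot, card_Comp_undefOn] at hsplit
    have h' := congrArg (Nat.cast (R := ℝ)) h
    have hsplit' := congrArg (Nat.cast (R := ℝ)) hsplit
    push_cast at h' hsplit'
    rw [satCount]
    linarith
  · apply satProb_undefOn_of_eq
    rw [← card_filter_Comp_undefOn_eq hx true, satCount]
    congr 2
    refine Finset.filter_congr fun z hz => ?_
    simp [SatClause, mem_Comp_undefOn.1 hz y hy]
  · refine satProb_undefOn_of_forall fun z hz => ?_
    simp [SatClause, mem_Comp_undefOn.1 hz x hx]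

theorem satProb_undefOn_pos_pos {α : Type} [Fintype α] [DecidableEq α] {K : Finset α}
    {x y : α} (h : ¬ (x ∈ K ∧ y ∈ K)) :
    satProb [(x, true), (y, true)] (undefOn K) = 1 := by
  refine satProb_undefOn_of_forall fun z hz => ?_
  rw [mem_Comp_undefOn] at hz
  by_cases hx : x ∈ K
  · simp [SatClause, hz y fun hy => h ⟨hx, hy⟩]
  · simp [SatClause, hz x hx]

theorem Eexp_phiG {V : Type} [Fintype V] [DecidableEq V] [LinearOrder V]
    (G : SimpleGraph V) [DecidableRel G.Adj] (k : ℕ) (μ : V → Option Bool) :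
    Eexp (phiG G k) μ
      = ∑ x, (((G.degree x - (k - 1) / 2 : ℕ) : ℝ) * satProb [(x, false)] μ
          + ∑ y ∈ G.neighborFinset x, satProb [(x, true), (y, false)] μ)
        + ∑ x, ∑ y, if x < y ∧ ¬ G.Adj x y then
            ((4 * G.edgeFinset.card : ℕ) : ℝ) * satProb [(x, true), (y, true)] μ else 0 := by
  rw [Eexp_eq_sum_satProb, phiG, Finset.sum_add_distrib]
  simp only [Multiset.map_add, Multiset.sum_add, Multiset.map_bind, Multiset.sum_bind,
    Multiset.map_replicate, Multiset.sum_replicate, Multiset.map_map, nsmul_eq_mul]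
  congr 1
  refine Finset.sum_congr rfl fun x _ => Finset.sum_congr rfl fun y _ => ?_
  split_ifs <;> simp

theorem Eexp_phiG_undefOn {V : Type} [Fintype V] [DecidableEq V] [LinearOrder V]
    (G : SimpleGraph V) [DecidableRel G.Adj] {k : ℕ} {K : Finset V}
    (hK : G.IsClique (K : Set V))
    (hbal : ∀ x ∈ K, ((G.degree x - (k - 1) / 2 : ℕ) : ℝ)
      = G.degree x - ((G.neighborFinset x ∩ K).card : ℝ) / 2) :
    Eexp (phiG G k) (undefOn K)
      = ∑ x, (G.degree x : ℝ)
        + ∑ x, ∑ y, if x < y ∧ ¬ G.Adj x y then ((4 * G.edgeFinset.card : ℕ) : ℝ) else 0 := by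
  rw [Eexp_phiG]
  congr 1
  · refine Finset.sum_congr rfl fun x _ => ?_
    rw [satProb_undefOn_neg, Finset.sum_congr rfl fun y hy =>
      satProb_undefOn_pos_neg K ((G.mem_neighborFinset x y).1 hy).ne]
    by_cases hx : x ∈ K
    · have hterm : ∀ y, (if y ∈ K then (3 / 4 : ℝ) else 1 / 2)
          = 1 / 2 + if y ∈ K then 1 / 4 else 0 := by
        intro y; split_ifs <;> norm_num
      simp only [if_pos hx, hterm, Finset.sum_add_distrib, Finset.sum_const,
        G.card_neighborFinset_eq_degree, hbal x hx, Finset.sum_ite_mem, nsmul_eq_mul]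
      ring
    · simp [hx]
  · refine Finset.sum_congr rfl fun x _ => Finset.sum_congr rfl fun y _ => ?_
    split_ifs with h
    · rw [satProb_undefOn_pos_pos fun hxy => h.2 (hK hxy.1 hxy.2 h.1.ne), mul_one]
    · rfl

/-- If `K` is a clique of size `k` in `G`, then undefining exactly the
variables of `K` in the all-ones assignment preserves the expected number of
satisfied clauses of the reduction formula. -/
theorem stmt10 {V : Type} [Fintype V] [DecidableEq V] [LinearOrder V]
    (G : SimpleGraph V) [DecidableRel G.Adj]
    (k : ℕ) (hk : 3 ≤ k) (hodd : Odd k)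
    (hdeg : ∀ x : V, k - 1 ≤ G.degree x)
    (K : Finset V) (hK : G.IsNClique k K) :
    Eexp (phiG G k) (fun x => if x ∈ K then none else some true)
      = Eexp (phiG G k) (fun _ => some true) := by
  have hσ : (fun _ : V => some true) = undefOn ∅ := by
    funext i; simp [undefOn]
  change Eexp (phiG G k) (undefOn K) = _
  rw [hσ, Eexp_phiG_undefOn G hK.isClique, Eexp_phiG_undefOn G (by simp) (by simp)]
  intro x hx
  have hinter : G.neighborFinset x ∩ K = K.erase x := by
    ext y
    simp only [Finset.mem_inter, SimpleGraph.mem_neighborFinset, Finset.mem_erase]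
    exact ⟨fun h => ⟨h.1.ne', h.2⟩, fun h => ⟨hK.isClique hx h.2 h.1.symm, h.2⟩⟩
  obtain ⟨m, rfl⟩ := hodd
  have hd := hdeg x
  rw [hinter, Finset.card_erase_of_mem hx, hK.card_eq, Nat.cast_sub (by omega)]
  simp
end

section
/- Let φ be a CNF formula over variables {x_1,…,x_n} consisting of m clauses counted with multiplicity, where m is a power of 2. Then there exists a decision tree T of dimension n + m − 1 (whose features are the n variables together with m − 1 fresh features) such that for every partial assignment μ of {x_1,…,x_n}, letting y_μ be the partial instance of dimension n + m − 1 that agrees with μ on the first n components and is ⊥ on the remaining m − 1 components, one has |{z ∈ Comp(y_μ) : T(z) = 1}| / 2^{|y_μ|_⊥} = E(φ, μ)/m. -/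
/-- Binary decision trees whose internal nodes are labeled by features in `α`. -/
inductive DT (α : Type) : Type where
  | leaf (b : Bool)
  | node (i : α) (t0 t1 : DT α)

namespace DT

/-- Evaluation of a decision tree on an instance. -/
def eval {α : Type} : DT α → (α → Bool) → Bool
  | leaf b, _ => b
  | node i t0 t1, z => if z i then eval t1 z else eval t0 z

/-- The set of features appearing in a tree. -/
def vars {α : Type} [DecidableEq α] : DT α → Finset α
  | leaf _ => ∅
  | node i t0 t1 => insert i (vars t0 ∪ vars t1)

/-- No feature appears twice on any root-to-leaf path. -/
def ReadOnce {α : Type} [DecidableEq α] : DT α → Prop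
  | leaf _ => True
  | node i t0 t1 => i ∉ vars t0 ∧ i ∉ vars t1 ∧ ReadOnce t0 ∧ ReadOnce t1

/-- The number of internal nodes of a tree. -/
def internals {α : Type} : DT α → ℕ
  | leaf _ => 0
  | node _ t0 t1 => 1 + internals t0 + internals t1

/-- The total number of nodes (internal nodes and leaves) of a tree. -/
def size {α : Type} : DT α → ℕ
  | leaf _ => 1
  | node _ t0 t1 => 1 + size t0 + size t1

/-- The label sequences of all root-to-leaf paths of a tree. -/
def paths {α : Type} : DT α → List (List α)
  | leaf _ => [[]]
  | node i t0 t1 => (paths t0 ++ paths t1).map (fun p => i :: p)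

end DT

/-- Extend a partial assignment on the `n` variables to a partial instance of
dimension `n + m'` which is undefined on the `m'` fresh features. -/
def extAssign {n : ℕ} (m' : ℕ) (μ : Fin n → Option Bool) :
    Fin (n + m') → Option Bool :=
  fun i => if h : (i : ℕ) < n then μ ⟨i, h⟩ else none

namespace DT

/-- The value of a tree only depends on the features appearing in it. -/
theorem eval_congr {α : Type} [DecidableEq α] (t : DT α) {z w : α → Bool}
    (h : ∀ i ∈ t.vars, z i = w i) : t.eval z = t.eval w := by
  induction t with
  | leaf b => rfl
  | node i t0 t1 ih0 ih1 =>
    simp only [vars, Finset.mem_insert, Finset.mem_union] at h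
    simp only [eval]
    rw [h i (Or.inl rfl), ih0 fun j hj => h j (Or.inr (Or.inl hj)),
      ih1 fun j hj => h j (Or.inr (Or.inr hj))]

/-- The decision list testing the literals of a clause one after the other. -/
def ofClause {α : Type} : List (α × Bool) → DT α
  | [] => leaf false
  | (i, true) :: C => node i (ofClause C) (leaf true)
  | (i, false) :: C => node i (leaf true) (ofClause C)

theorem eval_ofClause {α : Type} (C : List (α × Bool)) (z : α → Bool) :
    (ofClause C).eval z = true ↔ SatClause C z := by
  induction C with
  | nil => simp [ofClause, eval, SatClause]
  | cons l C ih =>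
    obtain ⟨i, b⟩ := l
    simp only [SatClause] at ih
    cases b <;> cases hz : z i <;> simp [ofClause, eval, SatClause, hz, ih]

theorem vars_ofClause {α : Type} [DecidableEq α] (C : List (α × Bool)) :
    (ofClause C).vars = (C.map Prod.fst).toFinset := by
  induction C with
  | nil => rfl
  | cons l C ih =>
    obtain ⟨i, b⟩ := l
    cases b <;> simp [ofClause, vars, ih]

theorem readOnce_ofClause {α : Type} [DecidableEq α] {C : List (α × Bool)}
    (hC : (C.map Prod.fst).Nodup) : (ofClause C).ReadOnce := by
  induction C with
  | nil => trivial
  | cons l C ih =>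
    obtain ⟨i, b⟩ := l
    rw [List.map_cons, List.nodup_cons] at hC
    have hi : i ∉ (ofClause C).vars := by
      rw [vars_ofClause, List.mem_toFinset]
      exact hC.1
    cases b <;> simp [ofClause, ReadOnce, vars, hi, ih hC.2]

end DT

/-- The number of completions of `y` accepted by the tree `t`. -/
def acceptCount {α : Type} [Fintype α] [DecidableEq α] (t : DT α) (y : α → Option Bool) : ℕ :=
  ((Comp y).filter (fun z => t.eval z = true)).card

/-- Flipping an undefined feature permutes the completions. -/
theorem update_mem_Comp {α : Type} [Fintype α] [DecidableEq α] {y : α → Option Bool} {i : α}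
    (hi : y i = none) {z : α → Bool} (hz : z ∈ Comp y) (b : Bool) :
    Function.update z i b ∈ Comp y := by
  simp only [Comp, Finset.mem_filter, Finset.mem_univ, true_and] at hz ⊢
  intro j c hj
  have hji : j ≠ i := by
    rintro rfl
    simp [hi] at hj
  rw [Function.update_of_ne hji]
  exact hz j c hj

/-- An undefined feature that a tree does not test splits its accepted completions in half. -/
theorem acceptCount_eq_two_mul {α : Type} [Fintype α] [DecidableEq α] {y : α → Option Bool}
    {i : α} (hi : y i = none) {t : DT α} (ht : i ∉ t.vars) (b : Bool) :
    acceptCount t y = 2 * ((Comp y).filter (fun z => t.eval z = true ∧ z i = b)).card := by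
  have hflip : ((Comp y).filter (fun z => t.eval z = true ∧ z i = !b)).card
      = ((Comp y).filter (fun z => t.eval z = true ∧ z i = b)).card := by
    have heval : ∀ (z : α → Bool) (c : Bool), t.eval (Function.update z i c) = t.eval z :=
      fun z c => t.eval_congr fun j hj =>
        Function.update_of_ne (ne_of_mem_of_not_mem hj ht) _ _
    refine Finset.card_bij' (fun z _ => Function.update z i b)
      (fun z _ => Function.update z i (!b)) ?_ ?_ ?_ ?_
    · intro z hz
      simp only [Finset.mem_filter] at hz ⊢
      exact ⟨update_mem_Comp hi hz.1 b, by rw [heval]; exact hz.2.1, by simp⟩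
    · intro z hz
      simp only [Finset.mem_filter] at hz ⊢
      exact ⟨update_mem_Comp hi hz.1 _, by rw [heval]; exact hz.2.1, by simp⟩
    · intro z hz
      simp only [Finset.mem_filter] at hz
      simp [← hz.2.2]
    · intro z hz
      simp only [Finset.mem_filter] at hz
      simp [← hz.2.2]
  have hsplit := Finset.card_filter_add_card_filter_not
    (s := (Comp y).filter (fun z => t.eval z = true)) (fun z => z i = b)
  simp only [Finset.filter_filter, ← Bool.eq_not] at hsplit
  rw [acceptCount, ← hsplit, hflip, two_mul]

theorem two_mul_acceptCount_node {α : Type} [Fintype α] [DecidableEq α] {y : α → Option Bool}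
    {i : α} (hi : y i = none) {t0 t1 : DT α} (h0 : i ∉ t0.vars) (h1 : i ∉ t1.vars) :
    2 * acceptCount (.node i t0 t1) y = acceptCount t0 y + acceptCount t1 y := by
  rw [acceptCount_eq_two_mul hi h0 false, acceptCount_eq_two_mul hi h1 true, ← mul_add]
  congr 1
  rw [acceptCount, ← Finset.card_union_of_disjoint, ← Finset.filter_or]
  · congr 1
    refine Finset.filter_congr fun z _ => ?_
    cases hz : z i <;> simp [DT.eval, hz]
  · rw [Finset.disjoint_filter]
    intro z _ hz hz'
    simp [hz.2] at hz'

theorem extAssign_castAdd {n : ℕ} (k : ℕ) (μ : Fin n → Option Bool) (i : Fin n) :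
    extAssign k μ (Fin.castAdd k i) = μ i := by
  simp [extAssign]

theorem extAssign_natAdd {n : ℕ} (k : ℕ) (μ : Fin n → Option Bool) (i : Fin k) :
    extAssign k μ (Fin.natAdd n i) = none := by
  simp [extAssign]

theorem numUndef_extAssign {n : ℕ} (k : ℕ) (μ : Fin n → Option Bool) :
    numUndef (extAssign k μ) = numUndef μ + k := by
  simp only [numUndef, Finset.card_filter, Fin.sum_univ_add, extAssign_castAdd, extAssign_natAdd]
  simp

theorem append_mem_Comp_extAssign {n k : ℕ} {μ : Fin n → Option Bool} (z : Fin n → Bool)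
    (w : Fin k → Bool) : Fin.append z w ∈ Comp (extAssign k μ) ↔ z ∈ Comp μ := by
  simp [Comp, Fin.forall_fin_add, extAssign_castAdd, extAssign_natAdd]

theorem satClause_map {α β : Type} (f : α → β) (C : List (α × Bool)) (z : β → Bool) :
    SatClause (C.map (Prod.map f id)) z ↔ SatClause C (z ∘ f) := by
  simp only [SatClause, List.mem_map, exists_exists_and_eq_and]
  rfl

/-- Adding `k` fresh features multiplies the number of satisfying completions by `2 ^ k`. -/
theorem acceptCount_ofClause {n : ℕ} (k : ℕ) (C : List (Fin n × Bool)) (μ : Fin n → Option Bool) :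
    acceptCount (DT.ofClause (C.map (Prod.map (Fin.castAdd k) id))) (extAssign k μ)
      = satCount C μ * 2 ^ k := by
  have hcard : (Finset.univ : Finset (Fin k → Bool)).card = 2 ^ k := by simp
  rw [satCount, ← hcard, ← Finset.card_product, acceptCount]
  symm
  refine Finset.card_equiv (Fin.appendEquiv n k) ?_
  rintro ⟨z, w⟩
  have happ : Fin.append z w ∘ Fin.castAdd k = z := by
    ext i
    simp
  simp [Fin.appendEquiv, append_mem_Comp_extAssign, DT.eval_ofClause, satClause_map, happ]

/-- A uniform choice among `2 ^ k` clauses, made with the first `k` of `M` fresh features. -/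
theorem exists_tree_of_card_eq_two_pow {n M k : ℕ} (hk : k ≤ M)
    (φ : Multiset (List (Fin n × Bool))) (hcl : ∀ C ∈ φ, (C.map Prod.fst).Nodup)
    (hφ : φ.card = 2 ^ k) :
    ∃ T : DT (Fin (n + M)), T.ReadOnce ∧ (∀ i ∈ T.vars, (i : ℕ) < n + k) ∧
      ∀ μ : Fin n → Option Bool, 2 ^ k * acceptCount T (extAssign M μ)
        = 2 ^ M * (φ.map (fun C => satCount C μ)).sum := by
  induction k generalizing φ with
  | zero =>
    obtain ⟨C, rfl⟩ := Multiset.card_eq_one.mp hφ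
    refine ⟨DT.ofClause (C.map (Prod.map (Fin.castAdd M) id)), DT.readOnce_ofClause ?_, ?_, ?_⟩
    · have h := (hcl C (Multiset.mem_singleton_self C)).map (Fin.castAdd_injective n M)
      simpa [Function.comp_def] using h
    · simp only [DT.vars_ofClause, List.mem_toFinset, List.map_map, List.mem_map]
      rintro i ⟨l, -, rfl⟩
      simp
    · intro μ
      simp [acceptCount_ofClause, mul_comm]
  | succ k ih =>
    obtain ⟨φ0, φ1, rfl, h0⟩ : ∃ φ0 φ1, φ = φ0 + φ1 ∧ φ0.card = 2 ^ k := by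
      induction φ using Quotient.inductionOn with
      | h l =>
        refine ⟨l.take (2 ^ k), l.drop (2 ^ k), by simp, ?_⟩
        have hl : l.length = 2 ^ (k + 1) := hφ
        simp [hl, pow_succ]
    have h1 : φ1.card = 2 ^ k := by
      rw [Multiset.card_add, h0, pow_succ] at hφ
      omega
    obtain ⟨T0, hr0, hv0, hT0⟩ := ih (by omega) φ0
      (fun C hC => hcl C (Multiset.mem_add.mpr (Or.inl hC))) h0
    obtain ⟨T1, hr1, hv1, hT1⟩ := ih (by omega) φ1
      (fun C hC => hcl C (Multiset.mem_add.mpr (Or.inr hC))) h1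
    have hn0 : Fin.natAdd n ⟨k, hk⟩ ∉ T0.vars := fun h => by simpa using hv0 _ h
    have hn1 : Fin.natAdd n ⟨k, hk⟩ ∉ T1.vars := fun h => by simpa using hv1 _ h
    refine ⟨.node (Fin.natAdd n ⟨k, hk⟩) T0 T1, ⟨hn0, hn1, hr0, hr1⟩, ?_, ?_⟩
    · simp only [DT.vars, Finset.mem_insert, Finset.mem_union]
      rintro i (rfl | hi | hi)
      · simp
      · have := hv0 i hi
        omega
      · have := hv1 i hi
        omega
    · intro μ
      rw [pow_succ, mul_assoc, two_mul_acceptCount_node (extAssign_natAdd M μ _) hn0 hn1,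
        mul_add, hT0, hT1, Multiset.map_add, Multiset.sum_add, mul_add]

/-- For a CNF multiset `φ` over `n` variables with `m` clauses counted with
multiplicity, `m` a power of two, there is a decision tree of dimension
`n + m − 1` whose acceptance probability on the completions of the extension
`y_μ` of any partial assignment `μ` equals `E(φ, μ)/m`. -/
theorem stmt12 {n : ℕ} (φ : Multiset (List (Fin n × Bool)))
    (hcl : ∀ C ∈ φ, (C.map Prod.fst).Nodup)
    (m : ℕ) (hm : Multiset.card φ = m) (hpow : ∃ j : ℕ, m = 2 ^ j) :
    ∃ T : DT (Fin (n + (m - 1))), T.ReadOnce ∧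
      ∀ μ : Fin n → Option Bool,
        (((Comp (extAssign (m - 1) μ)).filter
            (fun z => T.eval z = true)).card : ℝ)
            / 2 ^ numUndef (extAssign (m - 1) μ)
          = Eexp φ μ / m := by
  obtain ⟨j, rfl⟩ := hpow
  obtain ⟨T, hr, -, hT⟩ := exists_tree_of_card_eq_two_pow (M := 2 ^ j - 1)
    (Nat.le_sub_one_of_lt Nat.lt_two_pow_self) φ hcl hm
  refine ⟨T, hr, fun μ => ?_⟩
  have hμ : (2 : ℝ) ^ j * acceptCount T (extAssign (2 ^ j - 1) μ)
      = 2 ^ (2 ^ j - 1) * (φ.map (fun C => (satCount C μ : ℝ))).sum := by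
    have h := congrArg (Nat.cast : ℕ → ℝ) (hT μ)
    push_cast [Nat.cast_multiset_sum, Multiset.map_map, Function.comp_def] at h
    exact h
  change (acceptCount T (extAssign (2 ^ j - 1) μ) : ℝ) / _ = _
  rw [numUndef_extAssign, Eexp, pow_add, div_div, Nat.cast_pow, Nat.cast_ofNat,
    div_eq_div_iff (by positivity) (by positivity)]
  linear_combination 2 ^ numUndef μ * hμ
end
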